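/- For q > 0 and every x ∈ ℝ, lim_{m→∞} W^{(q)}(x+m)/W^{(q)}(m) = e^{Φ(q)x}; moreover, if W^{(q)} is continuously differentiable on (0,∞) with derivative W^{(q)′}, then lim_{m→∞} W^{(q)′}(x+m)/W^{(q)}(m) = Φ(q) e^{Φ(q)x}. -/

import Mathlib

open MeasureTheory Set Filter Topology

/-- The Laplace exponent of a spectrally negative Lévy process with triplet `(γ, σ, ν)`. -/
noncomputable def levyPsi (γ σ : ℝ) (ν : Measure ℝ) (l : ℝ) : ℝ :=
  γ * l + σ ^ 2 / 2 * l ^ 2 +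
    ∫ z in Set.Ioi (0 : ℝ),
      (Real.exp (-l * z) - 1 +
        l * z * Set.indicator (Set.Ioc (0 : ℝ) 1) (fun _ => (1 : ℝ)) z) ∂ν

/-- The right-inverse `Φ(q) = sup {λ ≥ 0 : f(λ) = q}` of a Laplace exponent `f`. -/
noncomputable def levyPhi (f : ℝ → ℝ) (q : ℝ) : ℝ :=
  sSup {l : ℝ | 0 ≤ l ∧ f l = q}

/-- `∫₀¹ z ν(dz)`, as an extended nonnegative real. -/
noncomputable def smallJumpMass (ν : Measure ℝ) : ENNReal :=
  ∫⁻ z in Set.Ioc (0 : ℝ) 1, ENNReal.ofReal z ∂ν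

/-- `ν` is a Lévy measure on `(0,∞)`: it charges only `(0,∞)` and
integrates `min(1, z²)`. -/
def IsLevyMeasure (ν : Measure ℝ) : Prop :=
  ν (Set.Iic 0) = 0 ∧ (∫⁻ z in Set.Ioi (0 : ℝ), ENNReal.ofReal (min 1 (z ^ 2)) ∂ν) ≠ ⊤

/-- The process is not the negative of a subordinator: `σ > 0`, or
`∫₀¹ z ν(dz) = ∞`, or `γ + ∫₀¹ z ν(dz) > 0`. -/
def NonDegenerate (γ σ : ℝ) (ν : Measure ℝ) : Prop :=
  0 < σ ∨ smallJumpMass ν = ⊤ ∨ 0 < γ + (smallJumpMass ν).toReal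

/-- `W` is the `q`-scale function associated with the Laplace exponent `f`,
where `Φq` is the value of the right-inverse of `f` at `q`. -/
def IsScaleFunction (f : ℝ → ℝ) (Φq q : ℝ) (W : ℝ → ℝ) : Prop :=
  (∀ x < 0, W x = 0) ∧ ContinuousOn W (Set.Ici 0) ∧ MonotoneOn W (Set.Ici 0) ∧
    ∀ l, Φq < l → (∫ y in Set.Ioi (0 : ℝ), Real.exp (-l * y) * W y) = 1 / (f l - q)

/-- Admissibility of the refraction parameter `α`: `α > 0`, and when the paths
have bounded variation (`σ = 0` and `∫₀¹ z ν(dz) < ∞`), `α` is smaller than the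
drift `c = γ + ∫₀¹ z ν(dz)`. -/
def AlphaAdmissible (γ σ α : ℝ) (ν : Measure ℝ) : Prop :=
  0 < α ∧ ((σ = 0 ∧ smallJumpMass ν ≠ ⊤) → α < γ + (smallJumpMass ν).toReal)

theorem log_concave_of_convolution_eq_zero {a b : ℕ → ℝ} (ha : ∀ n, 0 < a n) (hb0 : 0 < b 0)
    (hb : ∀ j, 0 ≤ b (j + 2))
    (hab : ∀ n, ∑ j ∈ Finset.range (n + 2), b j * a (n + 1 - j) = 0) (n : ℕ) :
    ∀ i ≤ n, a i * a (n + 1) ≤ a (i + 1) * a n := by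
  induction n with
  | zero =>
    intro i hi
    obtain rfl : i = 0 := by omega
    exact (mul_comm _ _).le
  | succ n ih =>
    have h1 := hab n
    have h2 := hab (n + 1)
    rw [Finset.sum_range_succ', Finset.sum_range_succ'] at h1 h2
    rw [Finset.sum_range_succ] at h2
    simp only [Nat.reduceAdd, Nat.sub_zero, add_tsub_cancel_right, zero_add, add_assoc] at h1 h2
    have e2 : n + (1 + 1) - (n + 2) = 0 := by omega
    rw [e2] at h2
    have hle : a n * ∑ x ∈ Finset.range n, b (x + 2) * a (n + (1 + 1) - (x + 2)) ≥
        a (n + 1) * ∑ x ∈ Finset.range n, b (x + 2) * a (n + 1 - (x + 2)) := by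
      rw [Finset.mul_sum, Finset.mul_sum]
      refine Finset.sum_le_sum fun x hx => ?_
      have hx' := Finset.mem_range.1 hx
      have := ih (n - 1 - x) (by omega)
      have e3 : n - 1 - x + 1 = n + (1 + 1) - (x + 2) := by omega
      have e4 : n - 1 - x = n + 1 - (x + 2) := by omega
      rw [e3, e4] at this
      have := mul_le_mul_of_nonneg_left this (hb x)
      linarith
    have hlast : 0 ≤ a n * (b (n + 2) * a 0) :=
      mul_nonneg (ha _).le (mul_nonneg (hb n) (ha 0).le)
    have key : a n * a (n + 2) ≤ a (n + 1) * a (n + 1) := by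
      have : b 0 * (a n * a (n + 2)) ≤ b 0 * (a (n + 1) * a (n + 1)) := by
        have e5 : n + (1 + 1) - 1 = n + 1 := rfl
        rw [e5] at h2
        have h3 := congrArg (fun t => a n * t) h2
        have h4 := congrArg (fun t => a (n + 1) * t) h1
        simp only [mul_add, mul_zero] at h3 h4
        linarith
      exact le_of_mul_le_mul_left this hb0
    intro i hi
    rcases Nat.lt_or_ge n i with h | h
    · obtain rfl : i = n + 1 := by omega
      exact (mul_comm _ _).le
    · have h3 := ih i h
      refine le_of_mul_le_mul_right (a := a n) ?_ (ha n)
      calc a i * a (n + 1 + 1) * a n = a i * (a n * a (n + 2)) := by ring_nf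
        _ ≤ a i * (a (n + 1) * a (n + 1)) := mul_le_mul_of_nonneg_left key (ha i).le
        _ = a i * a (n + 1) * a (n + 1) := by ring
        _ ≤ a (i + 1) * a n * a (n + 1) := mul_le_mul_of_nonneg_right h3 (ha _).le
        _ = _ := by ring

theorem log_concave_shift {a : ℕ → ℝ} (ha : ∀ n, 0 < a n)
    (h : ∀ n, ∀ i ≤ n, a i * a (n + 1) ≤ a (i + 1) * a n) {j k : ℕ} (hjk : j ≤ k) (N : ℕ) :
    a j * a (k + N) ≤ a (j + N) * a k := by
  induction N with
  | zero => simp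
  | succ N ih =>
    have h1 := h (k + N) (j + N) (by omega)
    refine le_of_mul_le_mul_right (a := a (j + N) * a (k + N)) ?_ (mul_pos (ha _) (ha _))
    calc a j * a (k + (N + 1)) * (a (j + N) * a (k + N))
        = (a j * a (k + N)) * (a (j + N) * a (k + N + 1)) := by ring_nf
      _ ≤ (a (j + N) * a k) * (a (j + N + 1) * a (k + N)) :=
          mul_le_mul ih h1 (mul_pos (ha _) (ha _)).le (mul_pos (ha _) (ha _)).le
      _ = _ := by ring_nf

theorem iteratedDeriv_integral_exp_neg_mul {ρ : Measure ℝ} {c : ℝ}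
    (h : ∀ l, c < l → Integrable (fun z => Real.exp (-l * z)) ρ) {l : ℝ} (hl : c < l) (n : ℕ) :
    AnalyticAt ℝ (fun l => ∫ z, Real.exp (-l * z) ∂ρ) l ∧
      Integrable (fun z => (-z) ^ n * Real.exp (-l * z)) ρ ∧
      iteratedDeriv n (fun l => ∫ z, Real.exp (-l * z) ∂ρ) l =
        ∫ z, (-z) ^ n * Real.exp (-l * z) ∂ρ := by
  have hX : (fun l => ∫ z, Real.exp (-l * z) ∂ρ) =
      ProbabilityTheory.mgf (fun z : ℝ => -z) ρ := by
    funext l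
    simp only [ProbabilityTheory.mgf, neg_mul, mul_neg]
  have hmem : l ∈ interior (ProbabilityTheory.integrableExpSet (fun z : ℝ => -z) ρ) := by
    refine mem_interior.2 ⟨Ioi c, fun x hx => ?_, isOpen_Ioi, hl⟩
    have := h x hx
    simpa only [ProbabilityTheory.integrableExpSet, mem_ofPred_eq, neg_mul, mul_neg] using this
  rw [hX]
  refine ⟨ProbabilityTheory.analyticAt_mgf hmem, ?_, ?_⟩
  · have := ProbabilityTheory.integrable_pow_mul_exp_of_mem_interior_integrableExpSet hmem n
    simpa only [neg_mul, mul_neg] using this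
  · rw [ProbabilityTheory.iteratedDeriv_mgf hmem n]
    simp only [neg_mul, mul_neg]

theorem iteratedDeriv_integral_exp_neg_mul_mul {m : Measure ℝ} {w : ℝ → ℝ} (hw : AEMeasurable w m)
    (hw0 : ∀ᵐ z ∂m, 0 ≤ w z) {c : ℝ}
    (h : ∀ l, c < l → Integrable (fun z => Real.exp (-l * z) * w z) m)
    {l : ℝ} (hl : c < l) (n : ℕ) :
    AnalyticAt ℝ (fun l => ∫ z, Real.exp (-l * z) * w z ∂m) l ∧
      Integrable (fun z => (-z) ^ n * Real.exp (-l * z) * w z) m ∧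
      iteratedDeriv n (fun l => ∫ z, Real.exp (-l * z) * w z ∂m) l =
        ∫ z, (-z) ^ n * Real.exp (-l * z) * w z ∂m := by
  have hintegral : ∀ f : ℝ → ℝ, Integrable f (m.withDensity fun z => ENNReal.ofReal (w z)) ↔
      Integrable (fun z => f z * w z) m := by
    intro f
    rw [integrable_withDensity_iff_integrable_smul₀' hw.ennreal_ofReal (by simp)]
    refine integrable_congr ?_
    filter_upwards [hw0] with z hz
    rw [ENNReal.toReal_ofReal hz, smul_eq_mul, mul_comm]
  have heq : ∀ f : ℝ → ℝ, ∫ z, f z ∂(m.withDensity fun z => ENNReal.ofReal (w z)) =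
      ∫ z, f z * w z ∂m := by
    intro f
    rw [integral_withDensity_eq_integral_toReal_smul₀ hw.ennreal_ofReal (by simp)]
    refine integral_congr_ae ?_
    filter_upwards [hw0] with z hz
    rw [ENNReal.toReal_ofReal hz, smul_eq_mul, mul_comm]
  have := iteratedDeriv_integral_exp_neg_mul
    (ρ := m.withDensity fun z => ENNReal.ofReal (w z)) (fun l hl => (hintegral _).2 (h l hl)) hl n
  simpa only [heq, hintegral] using this

theorem exp_neg_le_one_sub_add_sq {x : ℝ} (hx : 0 ≤ x) : Real.exp (-x) ≤ 1 - x + x ^ 2 := by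
  have h1 := Real.add_one_le_exp x
  have h2 : Real.exp (-x) * Real.exp x = 1 := by rw [← Real.exp_add]; simp
  have h3 := Real.exp_pos (-x)
  have h4 : Real.exp (-x) * (x + 1) ≤ 1 := by
    exact (mul_le_mul_of_nonneg_left h1 h3.le).trans h2.le
  refine le_of_mul_le_mul_right (h4.trans ?_) (by linarith : 0 < x + 1)
  nlinarith [pow_nonneg hx 3]

theorem mul_exp_neg_le_one (x : ℝ) : x * Real.exp (-x) ≤ 1 := by
  have h1 := Real.add_one_le_exp x
  have h2 : Real.exp x * Real.exp (-x) = 1 := by rw [← Real.exp_add]; simp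
  nlinarith [Real.exp_pos (-x)]

theorem sq_mul_exp_neg_le_four {x : ℝ} (hx : 0 ≤ x) : x ^ 2 * Real.exp (-x) ≤ 4 := by
  have h1 := mul_exp_neg_le_one (x / 2)
  have h2 : Real.exp (-x) = Real.exp (-(x / 2)) * Real.exp (-(x / 2)) := by
    rw [← Real.exp_add]; ring_nf
  have h3 : 0 ≤ x / 2 * Real.exp (-(x / 2)) := by positivity
  rw [h2]
  nlinarith

theorem IsLevyMeasure.integrable_min {ν : Measure ℝ} (hν : IsLevyMeasure ν) :
    Integrable (fun z : ℝ => min 1 (z ^ 2)) (ν.restrict (Ioi 0)) := by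
  refine ⟨by fun_prop, ?_⟩
  rw [hasFiniteIntegral_iff_ofReal (ae_of_all _ fun z => by positivity)]
  exact hν.2.lt_top

theorem IsLevyMeasure.integrable_of_le {ν : Measure ℝ} (hν : IsLevyMeasure ν) {f : ℝ → ℝ}
    (hf : Measurable f) (K : ℝ) (h : ∀ z, 0 < z → |f z| ≤ K * min 1 (z ^ 2)) :
    Integrable f (ν.restrict (Ioi 0)) :=
  (hν.integrable_min.const_mul K).mono' hf.aestronglyMeasurable
    ((ae_restrict_iff' measurableSet_Ioi).2 (ae_of_all _ h))

theorem measurable_indicator_Ioc_one :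
    Measurable (Set.indicator (Set.Ioc (0 : ℝ) 1) (fun _ => (1 : ℝ))) :=
  measurable_const.indicator measurableSet_Ioc

theorem levy_integrand_abs_le {l z : ℝ} (hl : 0 ≤ l) (hz : 0 < z) :
    |Real.exp (-l * z) - 1 + l * z * Set.indicator (Set.Ioc (0 : ℝ) 1) (fun _ => (1 : ℝ)) z| ≤
      (l ^ 2 + 1) * min 1 (z ^ 2) := by
  have h0 : 0 ≤ l * z := by positivity
  have h1 := Real.add_one_le_exp (-(l * z))
  have h2 := exp_neg_le_one_sub_add_sq h0
  have h3 : Real.exp (-(l * z)) ≤ 1 := Real.exp_le_one_iff.2 (by linarith)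
  have h4 := Real.exp_pos (-(l * z))
  rw [neg_mul]
  rcases le_or_gt z 1 with h | h
  · rw [indicator_of_mem (show z ∈ Ioc (0 : ℝ) 1 from ⟨hz, h⟩), min_eq_right (by nlinarith),
        abs_le]
    constructor <;> nlinarith [sq_nonneg z, sq_nonneg (l * z)]
  · rw [indicator_of_notMem (fun hh => not_lt.2 hh.2 h), min_eq_left (by nlinarith), abs_le]
    constructor <;> nlinarith [sq_nonneg l]

theorem IsLevyMeasure.integrable_integrand {ν : Measure ℝ} (hν : IsLevyMeasure ν) {l : ℝ}
    (hl : 0 ≤ l) :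
    Integrable (fun z => Real.exp (-l * z) - 1 +
      l * z * Set.indicator (Set.Ioc (0 : ℝ) 1) (fun _ => (1 : ℝ)) z) (ν.restrict (Ioi 0)) := by
  have := measurable_indicator_Ioc_one
  exact hν.integrable_of_le (by fun_prop) _ fun z hz => levy_integrand_abs_le hl hz

theorem IsLevyMeasure.hasDerivAt_levyPsi {γ σ : ℝ} {ν : Measure ℝ} (hν : IsLevyMeasure ν)
    {l : ℝ} (hl : 0 < l) :
    HasDerivAt (levyPsi γ σ ν) (γ + σ ^ 2 * l + ∫ z in Ioi (0 : ℝ),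
      (z * Set.indicator (Set.Ioc (0 : ℝ) 1) (fun _ => (1 : ℝ)) z -
        z * Real.exp (-l * z)) ∂ν) l := by
  have hm := measurable_indicator_Ioc_one
  have hmem : Ioo (l / 2) (2 * l) ∈ 𝓝 l := Ioo_mem_nhds (by linarith) (by linarith)
  have key := (hasDerivAt_integral_of_dominated_loc_of_deriv_le (μ := ν.restrict (Ioi 0))
    (F := fun l z => Real.exp (-l * z) - 1 +
      l * z * Set.indicator (Set.Ioc (0 : ℝ) 1) (fun _ => (1 : ℝ)) z)
    (F' := fun l z => z * Set.indicator (Set.Ioc (0 : ℝ) 1) (fun _ => (1 : ℝ)) z -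
      z * Real.exp (-l * z)) (bound := fun z => (2 * l + 2 / l) * min 1 (z ^ 2)) hmem
    (Eventually.of_forall fun x => by fun_prop) (hν.integrable_integrand hl.le)
    (by fun_prop) ?_ (hν.integrable_min.const_mul _) ?_).2
  · have h2 : HasDerivAt (fun l : ℝ => γ * l + σ ^ 2 / 2 * l ^ 2) (γ + σ ^ 2 * l) l := by
      have := ((hasDerivAt_id l).const_mul γ).add (((hasDerivAt_id l).pow 2).const_mul (σ ^ 2 / 2))
      refine this.congr_deriv ?_
      simp
      ring
    exact h2.add key
  · refine (ae_restrict_iff' measurableSet_Ioi).2 (ae_of_all _ fun z (hz : 0 < z) x hx => ?_)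
    have hx0 : 0 < x := by linarith [hx.1]
    have h0 : 0 < x * z := by positivity
    have h1 := Real.add_one_le_exp (-(x * z))
    have h3 : Real.exp (-(x * z)) ≤ 1 := Real.exp_le_one_iff.2 (by linarith)
    have h4 := Real.exp_pos (-(x * z))
    have hl2 : 0 < 2 / l := by positivity
    rw [neg_mul, Real.norm_eq_abs]
    rcases le_or_gt z 1 with h | h
    · rw [indicator_of_mem (show z ∈ Ioc (0 : ℝ) 1 from ⟨hz, h⟩), min_eq_right (by nlinarith),
        abs_le]
      have h5 : z * (1 - Real.exp (-(x * z))) ≤ z * (x * z) :=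
        mul_le_mul_of_nonneg_left (by linarith) hz.le
      have h6 : z * (x * z) ≤ (2 * l) * z ^ 2 := by
        nlinarith [mul_le_mul_of_nonneg_right hx.2.le (sq_nonneg z)]
      have h7 : 0 ≤ z * (1 - Real.exp (-(x * z))) := mul_nonneg hz.le (by linarith)
      constructor <;> nlinarith [mul_nonneg hl2.le (sq_nonneg z), mul_nonneg hl.le (sq_nonneg z)]
    · rw [indicator_of_notMem (fun hh => not_lt.2 hh.2 h), min_eq_left (by nlinarith)]
      have h5 := mul_exp_neg_le_one (x * z)
      have h6 : z * Real.exp (-(x * z)) ≤ 2 / l := by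
        rw [le_div_iff₀ hl]
        nlinarith [mul_pos hz h4, hx.1]
      rw [abs_le]
      constructor <;> nlinarith [mul_pos hz h4]
  · refine ae_of_all _ fun z x _ => ?_
    have h1 : HasDerivAt (fun x : ℝ => Real.exp (-x * z)) (Real.exp (-x * z) * (-1 * z)) x :=
      (((hasDerivAt_id x).neg).mul_const z).exp
    have h2 := (h1.sub_const 1).add (((hasDerivAt_id x).mul_const z).mul_const
      (Set.indicator (Set.Ioc (0 : ℝ) 1) (fun _ => (1 : ℝ)) z))
    refine h2.congr_deriv ?_
    ring

theorem IsLevyMeasure.integrable_exp_mul_sq {ν : Measure ℝ} (hν : IsLevyMeasure ν)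
    {l : ℝ} (hl : 0 < l) :
    Integrable (fun z => Real.exp (-l * z) * z ^ 2) (ν.restrict (Ioi 0)) := by
  refine hν.integrable_of_le (by fun_prop) (1 + 4 / l ^ 2) fun z hz => ?_
  have h0 : 0 < l * z := by positivity
  have h1 := sq_mul_exp_neg_le_four h0.le
  have h3 : Real.exp (-(l * z)) ≤ 1 := Real.exp_le_one_iff.2 (by linarith)
  have h4 := Real.exp_pos (-(l * z))
  rw [neg_mul, abs_of_nonneg (by positivity)]
  have h5 : Real.exp (-(l * z)) * z ^ 2 ≤ 4 / l ^ 2 := by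
    rw [le_div_iff₀ (by positivity)]
    nlinarith
  have h6 : Real.exp (-(l * z)) * z ^ 2 ≤ z ^ 2 := by nlinarith [sq_nonneg z]
  have h7 : 0 < 4 / l ^ 2 := by positivity
  rcases min_cases 1 (z ^ 2) with ⟨h, -⟩ | ⟨h, -⟩ <;> rw [h] <;> nlinarith [sq_nonneg z]

theorem IsLevyMeasure.hasDerivAt_deriv_levyPsi {γ σ : ℝ} {ν : Measure ℝ} (hν : IsLevyMeasure ν)
    {l : ℝ} (hl : 0 < l) :
    HasDerivAt (deriv (levyPsi γ σ ν))
      (σ ^ 2 + ∫ z in Ioi (0 : ℝ), Real.exp (-l * z) * z ^ 2 ∂ν) l := by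
  have hm := measurable_indicator_Ioc_one
  have hmem : Ioi (l / 2) ∈ 𝓝 l := Ioi_mem_nhds (by linarith)
  have key := (hasDerivAt_integral_of_dominated_loc_of_deriv_le (μ := ν.restrict (Ioi 0))
    (F := fun l z => z * Set.indicator (Set.Ioc (0 : ℝ) 1) (fun _ => (1 : ℝ)) z -
      z * Real.exp (-l * z)) (x₀ := l)
    (F' := fun l z => Real.exp (-l * z) * z ^ 2)
    (bound := fun z => Real.exp (-(l / 2) * z) * z ^ 2) hmem
    (Eventually.of_forall fun x => by fun_prop) ?_
    (by fun_prop) ?_ (hν.integrable_exp_mul_sq (half_pos hl)) ?_).2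
  · have h2 : HasDerivAt (fun l : ℝ => γ + σ ^ 2 * l) (σ ^ 2) l := by
      simpa using ((hasDerivAt_id l).const_mul (σ ^ 2)).const_add γ
    refine (h2.add key).congr_of_eventuallyEq ?_
    filter_upwards [Ioi_mem_nhds hl] with x hx
    exact (hν.hasDerivAt_levyPsi hx).deriv
  · refine hν.integrable_of_le (by fun_prop) (l + 1 / l) fun z hz => ?_
    have h0 : 0 < l * z := by positivity
    have h1 := Real.add_one_le_exp (-(l * z))
    have h3 : Real.exp (-(l * z)) ≤ 1 := Real.exp_le_one_iff.2 (by linarith)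
    have h4 := Real.exp_pos (-(l * z))
    have hl2 : 0 < 1 / l := by positivity
    rw [neg_mul]
    rcases le_or_gt z 1 with h | h
    · rw [indicator_of_mem (show z ∈ Ioc (0 : ℝ) 1 from ⟨hz, h⟩), min_eq_right (by nlinarith),
        abs_le]
      have h5 : z * (1 - Real.exp (-(l * z))) ≤ z * (l * z) :=
        mul_le_mul_of_nonneg_left (by linarith) hz.le
      have h7 : 0 ≤ z * (1 - Real.exp (-(l * z))) := mul_nonneg hz.le (by linarith)
      constructor <;> nlinarith [mul_nonneg hl2.le (sq_nonneg z), mul_nonneg hl.le (sq_nonneg z)]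
    · rw [indicator_of_notMem (fun hh => not_lt.2 hh.2 h), min_eq_left (by nlinarith)]
      have h5 := mul_exp_neg_le_one (l * z)
      have h6 : z * Real.exp (-(l * z)) ≤ 1 / l := by
        rw [le_div_iff₀ hl]
        nlinarith
      rw [abs_le]
      constructor <;> nlinarith [mul_pos hz h4]
  · refine (ae_restrict_iff' measurableSet_Ioi).2 (ae_of_all _ fun z (hz : 0 < z) x hx => ?_)
    rw [Real.norm_of_nonneg (by positivity)]
    gcongr
    exact le_of_lt hx
  · refine ae_of_all _ fun z x _ => ?_
    have h1 : HasDerivAt (fun x : ℝ => Real.exp (-x * z)) (Real.exp (-x * z) * (-1 * z)) x :=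
      (((hasDerivAt_id x).neg).mul_const z).exp
    refine ((h1.const_mul z).const_sub _).congr_deriv ?_
    ring

theorem IsLevyMeasure.neg_one_pow_mul_iteratedDeriv_levyPsi_nonneg {γ σ : ℝ} {ν : Measure ℝ}
    (hν : IsLevyMeasure ν) {l : ℝ} (hl : 0 < l) (k : ℕ) :
    0 ≤ (-1) ^ k * iteratedDeriv (k + 2) (levyPsi γ σ ν) l := by
  obtain ⟨h1, h2, h3⟩ := iteratedDeriv_integral_exp_neg_mul_mul (m := ν.restrict (Ioi 0))
    (w := fun z => z ^ 2) (by fun_prop) (ae_of_all _ fun z => sq_nonneg z)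
    (fun l hl => hν.integrable_exp_mul_sq hl) hl k
  have heq : deriv (deriv (levyPsi γ σ ν)) =ᶠ[𝓝 l]
      (fun _ => σ ^ 2) + fun l => ∫ z in Ioi (0 : ℝ), Real.exp (-l * z) * z ^ 2 ∂ν := by
    filter_upwards [Ioi_mem_nhds hl] with x hx
    exact (hν.hasDerivAt_deriv_levyPsi hx).deriv
  rw [iteratedDeriv_succ', iteratedDeriv_succ', (heq.iteratedDeriv k).eq_of_nhds,
    iteratedDeriv_add contDiffAt_const h1.contDiffAt, h3, mul_add]
  refine add_nonneg ?_ ?_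
  · rw [iteratedDeriv_const]
    split_ifs with hk
    · subst hk; simpa using sq_nonneg σ
    · simp
  · rw [← integral_const_mul]
    refine setIntegral_nonneg measurableSet_Ioi fun z (hz : 0 < z) => ?_
    have : (-1 : ℝ) ^ k * ((-z) ^ k * Real.exp (-l * z) * z ^ 2) =
        z ^ k * Real.exp (-l * z) * z ^ 2 := by
      rw [neg_pow z, ← mul_assoc, ← mul_assoc, ← mul_assoc, ← mul_pow]; simp
    rw [this]
    positivity

theorem IsLevyMeasure.levyPsi_mul_le {γ σ : ℝ} {ν : Measure ℝ} (hν : IsLevyMeasure ν)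
    {l t : ℝ} (hl : 0 ≤ l) (ht0 : 0 ≤ t) (ht1 : t ≤ 1) :
    levyPsi γ σ ν (t * l) ≤ t * levyPsi γ σ ν l := by
  have h1 : ∫ z in Ioi (0 : ℝ), (Real.exp (-(t * l) * z) - 1 +
        (t * l) * z * Set.indicator (Set.Ioc (0 : ℝ) 1) (fun _ => (1 : ℝ)) z) ∂ν ≤
      t * ∫ z in Ioi (0 : ℝ), (Real.exp (-l * z) - 1 +
        l * z * Set.indicator (Set.Ioc (0 : ℝ) 1) (fun _ => (1 : ℝ)) z) ∂ν := by
    rw [← integral_const_mul]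
    refine integral_mono (hν.integrable_integrand (by positivity))
      ((hν.integrable_integrand hl).const_mul t) fun z => ?_
    have h2 := convexOn_exp.2 (mem_univ 0) (mem_univ (-l * z)) (sub_nonneg.2 ht1) ht0 (by ring)
    simp only [smul_eq_mul, mul_zero, Real.exp_zero, zero_add] at h2
    have e : -(t * l) * z = t * (-l * z) := by ring
    simp only [e]
    linarith
  have h3 : σ ^ 2 / 2 * (t * l) ^ 2 ≤ t * (σ ^ 2 / 2 * l ^ 2) := by
    nlinarith [mul_nonneg (mul_nonneg (sq_nonneg σ) (sq_nonneg l))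
      (mul_nonneg ht0 (sub_nonneg.2 ht1))]
  unfold levyPsi
  nlinarith

theorem IsLevyMeasure.measure_Ioi_one_ne_top {ν : Measure ℝ} (hν : IsLevyMeasure ν) :
    ν (Ioi 1) ≠ ⊤ := by
  refine ne_top_of_le_ne_top hν.2 ?_
  calc ν (Ioi 1) = ∫⁻ z in Ioi (1 : ℝ), 1 ∂ν := by simp
    _ ≤ ∫⁻ z in Ioi (1 : ℝ), ENNReal.ofReal (min 1 (z ^ 2)) ∂ν := by
      refine setLIntegral_mono (by fun_prop) fun z (hz : 1 < z) => ?_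
      rw [min_eq_left (by nlinarith)]; simp
    _ ≤ _ := lintegral_mono_set (Ioi_subset_Ioi zero_le_one)

theorem IsLevyMeasure.le_levyPsi {γ σ : ℝ} {ν : Measure ℝ} (hν : IsLevyMeasure ν)
    {l : ℝ} (hl : 0 ≤ l) :
    (∫⁻ z in Ioc (0 : ℝ) 1, ENNReal.ofReal (Real.exp (-l * z) - 1 + l * z) ∂ν) ≠ ⊤ ∧
    γ * l + σ ^ 2 / 2 * l ^ 2 +
      (∫⁻ z in Ioc (0 : ℝ) 1, ENNReal.ofReal (Real.exp (-l * z) - 1 + l * z) ∂ν).toReal -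
        (ν (Ioi 1)).toReal ≤ levyPsi γ σ ν l := by
  have hintegral := hν.integrable_integrand hl
  have hI : IntegrableOn (fun z => Real.exp (-l * z) - 1 + l * z) (Ioc 0 1) ν := by
    refine (IntegrableOn.mono_set hintegral Ioc_subset_Ioi_self).congr_fun (fun z hz => ?_)
      measurableSet_Ioc
    simp [indicator_of_mem hz]
  have hnn : 0 ≤ᵐ[ν.restrict (Ioc 0 1)] fun z => Real.exp (-l * z) - 1 + l * z :=
    ae_of_all _ fun z => by
      have := Real.add_one_le_exp (-l * z)
      simp only [Pi.zero_apply]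
      linarith
  refine ⟨((hasFiniteIntegral_iff_ofReal hnn).1 hI.2).ne, ?_⟩
  rw [← integral_eq_lintegral_of_nonneg_ae hnn hI.1]
  have hsplit := setIntegral_union (Ioc_disjoint_Ioi (le_refl (1 : ℝ))) measurableSet_Ioi
    (IntegrableOn.mono_set hintegral Ioc_subset_Ioi_self)
    (IntegrableOn.mono_set hintegral (Ioi_subset_Ioi (zero_le_one (α := ℝ))))
  rw [Ioc_union_Ioi_eq_Ioi zero_le_one] at hsplit
  have h1 : ∫ z in Ioc (0 : ℝ) 1, (Real.exp (-l * z) - 1 +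
        l * z * Set.indicator (Set.Ioc (0 : ℝ) 1) (fun _ => (1 : ℝ)) z) ∂ν =
      ∫ z in Ioc (0 : ℝ) 1, (Real.exp (-l * z) - 1 + l * z) ∂ν :=
    setIntegral_congr_fun measurableSet_Ioc fun z hz => by simp [indicator_of_mem hz]
  have h2 : -(ν (Ioi 1)).toReal ≤ ∫ z in Ioi (1 : ℝ), (Real.exp (-l * z) - 1 +
        l * z * Set.indicator (Set.Ioc (0 : ℝ) 1) (fun _ => (1 : ℝ)) z) ∂ν := by
    have : ∫ z in Ioi (1 : ℝ), (-1 : ℝ) ∂ν = -(ν (Ioi 1)).toReal := by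
      simp [Measure.real]
    rw [← this]
    refine setIntegral_mono_on (integrableOn_const hν.measure_Ioi_one_ne_top)
      (IntegrableOn.mono_set hintegral (Ioi_subset_Ioi zero_le_one)) measurableSet_Ioi
      fun z (hz : 1 < z) => ?_
    rw [indicator_of_notMem (fun hh => not_lt.2 hh.2 hz)]
    linarith [Real.exp_pos (-l * z)]
  unfold levyPsi
  rw [hsplit, h1]
  linarith

theorem smallJumpMass_le_liminf (ν : Measure ℝ) :
    smallJumpMass ν ≤ liminf (fun n : ℕ => ∫⁻ z in Ioc (0 : ℝ) 1,
      ENNReal.ofReal ((Real.exp (-(n : ℝ) * z) - 1 + n * z) / n) ∂ν) atTop := by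
  refine le_trans (le_of_eq ?_) (lintegral_liminf_le fun n => by fun_prop)
  refine setLIntegral_congr_fun measurableSet_Ioc fun z hz => ?_
  refine (Tendsto.liminf_eq ?_).symm
  refine (ENNReal.continuous_ofReal.tendsto z).comp ?_
  have h0 : Tendsto (fun n : ℕ => (n : ℝ) * z) atTop atTop :=
    tendsto_natCast_atTop_atTop.atTop_mul_const hz.1
  have h1 : Tendsto (fun n : ℕ => Real.exp (-((n : ℝ) * z))) atTop (𝓝 0) :=
    Real.tendsto_exp_neg_atTop_nhds_zero.comp h0
  have h2 : Tendsto (fun n : ℕ => (Real.exp (-((n : ℝ) * z)) - 1) / (n : ℝ)) atTop (𝓝 0) :=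
    (h1.sub_const 1).div_atTop tendsto_natCast_atTop_atTop
  have h3 := h2.add_const z
  rw [zero_add] at h3
  refine h3.congr' ?_
  filter_upwards [eventually_gt_atTop 0] with n hn
  have : (n : ℝ) ≠ 0 := by positivity
  rw [neg_mul]
  field_simp

theorem exists_lt_levyPsi {γ σ : ℝ} {ν : Measure ℝ} (hσ : 0 ≤ σ) (hν : IsLevyMeasure ν)
    (hnd : NonDegenerate γ σ ν) (q : ℝ) : ∃ l, 0 < l ∧ q < levyPsi γ σ ν l := by
  set N := (ν (Ioi 1)).toReal
  rcases hσ.lt_or_eq with hσ | hσ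
  · have h1 : Tendsto (fun l : ℝ => l * (γ + σ ^ 2 / 2 * l)) atTop atTop :=
      tendsto_id.atTop_mul_atTop₀ (tendsto_atTop_add_const_left _ _
        (tendsto_id.const_mul_atTop (by positivity)))
    obtain ⟨l, hl, hl0⟩ := ((h1.eventually_gt_atTop (q + N)).and (eventually_gt_atTop 0)).exists
    refine ⟨l, hl0, ?_⟩
    have h2 := (hν.le_levyPsi (γ := γ) (σ := σ) hl0.le).2
    have h3 := ENNReal.toReal_nonneg
      (a := ∫⁻ z in Ioc (0 : ℝ) 1, ENNReal.ofReal (Real.exp (-l * z) - 1 + l * z) ∂ν)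
    simp only [N] at hl
    nlinarith
  · obtain ⟨s, hs0, hs, hs1⟩ : ∃ s : ℝ, 0 ≤ s ∧ 0 < γ + s ∧
        (s = 0 ∨ ENNReal.ofReal s < smallJumpMass ν) := by
      rcases hnd with h | h | h
      · exact absurd h (by rw [← hσ]; exact lt_irrefl _)
      · exact ⟨|γ| + 1, by positivity, by linarith [neg_abs_le γ],
          Or.inr (by rw [h]; exact ENNReal.ofReal_lt_top)⟩
      · by_cases htop : smallJumpMass ν = ⊤
        · exact ⟨|γ| + 1, by positivity, by linarith [neg_abs_le γ],
            Or.inr (by rw [htop]; exact ENNReal.ofReal_lt_top)⟩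
        rcases le_or_gt 0 (-γ) with h0 | h0
        · refine ⟨(-γ + (smallJumpMass ν).toReal) / 2, by linarith, by linarith, Or.inr ?_⟩
          rw [ENNReal.ofReal_lt_iff_lt_toReal (by linarith) htop]
          linarith
        · exact ⟨0, le_rfl, by linarith, Or.inl rfl⟩
    have hev : ∀ᶠ n : ℕ in atTop, s * n ≤ (∫⁻ z in Ioc (0 : ℝ) 1,
        ENNReal.ofReal (Real.exp (-(n : ℝ) * z) - 1 + n * z) ∂ν).toReal := by
      rcases hs1 with rfl | hs1
      · exact Eventually.of_forall fun n => by simp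
      filter_upwards [eventually_lt_of_lt_liminf (hs1.trans_le (smallJumpMass_le_liminf ν)),
        eventually_gt_atTop 0] with n hn hn0
      have hn0' : (0 : ℝ) < n := by exact_mod_cast hn0
      have e : ∫⁻ z in Ioc (0 : ℝ) 1,
          ENNReal.ofReal ((Real.exp (-(n : ℝ) * z) - 1 + n * z) / n) ∂ν =
          (∫⁻ z in Ioc (0 : ℝ) 1, ENNReal.ofReal (Real.exp (-(n : ℝ) * z) - 1 + n * z) ∂ν) *
            ENNReal.ofReal (n : ℝ)⁻¹ := by
        rw [← lintegral_mul_const' _ _ ENNReal.ofReal_ne_top]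
        refine lintegral_congr fun z => ?_
        rw [div_eq_mul_inv, ENNReal.ofReal_mul' (by positivity)]
      rw [e, ENNReal.ofReal_lt_iff_lt_toReal hs0 (ENNReal.mul_ne_top
        (hν.le_levyPsi (γ := γ) (σ := σ) hn0'.le).1 ENNReal.ofReal_ne_top), ENNReal.toReal_mul,
        ENNReal.toReal_ofReal (by positivity), ← div_eq_mul_inv, lt_div_iff₀ hn0'] at hn
      exact hn.le
    have h1 : Tendsto (fun n : ℕ => (γ + s) * (n : ℝ)) atTop atTop :=
      tendsto_natCast_atTop_atTop.const_mul_atTop hs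
    obtain ⟨n, ⟨hn, hn1⟩, hn0⟩ :=
      ((hev.and (h1.eventually_gt_atTop (q + N))).and (eventually_gt_atTop 0)).exists
    have hn0' : (0 : ℝ) < n := by exact_mod_cast hn0
    refine ⟨n, hn0', ?_⟩
    have h2 := (hν.le_levyPsi (γ := γ) (σ := σ) hn0'.le).2
    simp only [N] at hn1
    nlinarith [mul_nonneg (sq_nonneg σ) (sq_nonneg (n : ℝ))]

theorem levyPhi_spec {γ σ : ℝ} {ν : Measure ℝ} (hσ : 0 ≤ σ) (hν : IsLevyMeasure ν)
    (hnd : NonDegenerate γ σ ν) {q : ℝ} (hq : 0 < q) :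
    0 < levyPhi (levyPsi γ σ ν) q ∧ levyPsi γ σ ν (levyPhi (levyPsi γ σ ν) q) = q ∧
      ∀ l, levyPhi (levyPsi γ σ ν) q < l → q < levyPsi γ σ ν l := by
  set f := levyPsi γ σ ν with hf
  obtain ⟨L, hL0, hL⟩ := exists_lt_levyPsi hσ hν hnd q
  have hcont : ∀ a b, 0 < a → ContinuousOn f (Icc a b) := fun a b ha x hx =>
    (hν.hasDerivAt_levyPsi (ha.trans_le hx.1)).continuousAt.continuousWithinAt
  have hfL : 0 < f L := hq.trans hL
  have hsmall : ∀ l, 0 ≤ l → l ≤ q / f L * L → f l ≤ q := by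
    intro l hl0 hl
    have ht1 : l / L ≤ q / f L := by rwa [div_le_iff₀ hL0]
    have ht2 : q / f L ≤ 1 := by rw [div_le_one hfL]; exact hL.le
    have := hν.levyPsi_mul_le (γ := γ) (σ := σ) hL0.le (by positivity : 0 ≤ l / L) (ht1.trans ht2)
    rw [div_mul_cancel₀ _ hL0.ne'] at this
    refine this.trans ?_
    rwa [← hf, ← le_div_iff₀ hfL]
  have hlarge : ∀ l, L ≤ l → q < f l := by
    intro l hl
    have hl0 := hL0.trans_le hl
    have := hν.levyPsi_mul_le (γ := γ) (σ := σ) hl0.le (by positivity : 0 ≤ L / l)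
      ((div_le_one hl0).2 hl)
    rw [div_mul_cancel₀ _ hl0.ne', ← hf] at this
    have h1 : L / l ≤ 1 := (div_le_one hl0).2 hl
    have h2 : 0 < L / l := by positivity
    by_contra! h
    nlinarith
  have hbdd : BddAbove {l : ℝ | 0 ≤ l ∧ f l = q} := ⟨L, fun l hl => by
    by_contra! h
    exact (hlarge l h.le).ne' hl.2⟩
  have hA : 0 < q / f L * L := by positivity
  have hAL : q / f L * L ≤ L := by
    have : q / f L ≤ 1 := by rw [div_le_one hfL]; exact hL.le
    nlinarith
  have hsup : ∀ l, 0 < l → f l ≤ q → ∃ x, l ≤ x ∧ f x = q := by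
    intro l hl0 hl
    have hlL : l ≤ L := by
      by_contra! h
      exact absurd hl (not_le.2 (hlarge l h.le))
    obtain ⟨x, hx, hxq⟩ := intermediate_value_Icc hlL (hcont l L hl0) ⟨hl, hL.le⟩
    exact ⟨x, hx.1, hxq⟩
  obtain ⟨x0, hx0, hx0q⟩ := hsup _ hA (hsmall _ hA.le le_rfl)
  have hΦx0 : x0 ≤ levyPhi f q := le_csSup hbdd ⟨(hA.trans_le hx0).le, hx0q⟩
  have hΦ0 : 0 < levyPhi f q := hA.trans_le (hx0.trans hΦx0)
  have hgt : ∀ l, levyPhi f q < l → q < f l := by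
    intro l hl
    by_contra! h
    obtain ⟨x, hx, hxq⟩ := hsup l (hΦ0.trans hl) h
    have : x ≤ levyPhi f q := le_csSup hbdd ⟨((hΦ0.trans hl).trans_le hx).le, hxq⟩
    linarith
  refine ⟨hΦ0, ?_, hgt⟩
  have hc : ContinuousAt f (levyPhi f q) := (hν.hasDerivAt_levyPsi hΦ0).continuousAt
  refine le_antisymm ?_ ?_
  · by_contra! h
    obtain ⟨e, he, hball⟩ := Metric.eventually_nhds_iff.1 (hc.eventually (lt_mem_nhds h))
    obtain ⟨y, hy, hye⟩ := exists_lt_of_lt_csSup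
      (s := {l : ℝ | 0 ≤ l ∧ f l = q}) ⟨x0, (hA.trans_le hx0).le, hx0q⟩
      (sub_lt_self (levyPhi f q) he)
    have hyl : y ≤ levyPhi f q := le_csSup hbdd hy
    have : dist y (levyPhi f q) < e := by rw [Real.dist_eq, abs_lt]; constructor <;> linarith
    exact (hball this).ne' hy.2
  · refine ge_of_tendsto
      (hc.tendsto.mono_left nhdsWithin_le_nhds : Tendsto f (𝓝[>] (levyPhi f q)) _) ?_
    filter_upwards [self_mem_nhdsWithin] with l hl
    exact (hgt l hl).le

theorem integral_pow_mul_exp_neg_mul_Ioi (n : ℕ) {r : ℝ} (hr : 0 < r) :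
    IntegrableOn (fun t : ℝ => t ^ n * Real.exp (-r * t)) (Ioi 0) ∧
      ∫ t in Ioi (0 : ℝ), t ^ n * Real.exp (-r * t) = n.factorial / r ^ (n + 1) := by
  have h := Real.integral_rpow_mul_exp_neg_mul_Ioi (a := (n : ℝ) + 1) (by positivity) hr
  simp only [add_sub_cancel_right, Real.rpow_natCast, ← neg_mul, Real.Gamma_nat_eq_factorial] at h
  have h2 : ∫ t in Ioi (0 : ℝ), t ^ n * Real.exp (-r * t) = n.factorial / r ^ (n + 1) := by
    rw [h, ← Nat.cast_succ, Real.rpow_natCast, one_div, inv_pow]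
    field_simp
  exact ⟨.of_integral_ne_zero (by rw [h2]; positivity), h2⟩

theorem abs_gamma_average_sub_le {W : ℝ → ℝ} (hW : ContinuousOn W (Ici 0)) {C c K x ε l : ℝ}
    (hc : 0 ≤ c) (hWC : ∀ t, 0 ≤ t → |W t| ≤ C * Real.exp (c * t)) (hK : 0 ≤ K)
    (hWK : ∀ t, 0 ≤ t → |W t - W x| ≤ ε + K * ((t - x) ^ 2 * Real.exp (c * t)))
    (hl : c < l) (k : ℕ) :
    |l ^ (k + 1) / k.factorial * (∫ t in Ioi (0 : ℝ), t ^ k * Real.exp (-l * t) * W t) - W x| ≤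
      ε + K * (Real.exp (c * ((k + 1) / (l - c))) *
        (((k + 1) / (l - c) - x) ^ 2 + (k + 1) / (l - c) / (l - c))) := by
  have hl0 : 0 < l := hc.trans_lt hl
  have hs : 0 < l - c := sub_pos.2 hl
  set s := l - c with hs_def
  have hexp : ∀ t, Real.exp (-l * t) * Real.exp (c * t) = Real.exp (-s * t) := fun t => by
    rw [← Real.exp_add]; congr 1; simp only [s]; ring
  have hf : (0 : ℝ) < k.factorial := by positivity
  set A : ℝ := l ^ (k + 1) / k.factorial with hA
  have hA0 : 0 < A := by positivity
  obtain ⟨i0, e0⟩ := integral_pow_mul_exp_neg_mul_Ioi k hl0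
  obtain ⟨i1, e1⟩ := integral_pow_mul_exp_neg_mul_Ioi k hs
  obtain ⟨i2, e2⟩ := integral_pow_mul_exp_neg_mul_Ioi (k + 1) hs
  obtain ⟨i3, e3⟩ := integral_pow_mul_exp_neg_mul_Ioi (k + 2) hs
  have hWm : AEStronglyMeasurable W (volume.restrict (Ioi 0)) :=
    (hW.mono Ioi_subset_Ici_self).aestronglyMeasurable measurableSet_Ioi
  have iW : IntegrableOn (fun t : ℝ => t ^ k * Real.exp (-l * t) * W t) (Ioi 0) := by
    refine (Integrable.const_mul i1 C).mono' ?_ ?_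
    · exact AEStronglyMeasurable.mul (by fun_prop) hWm
    · refine (ae_restrict_iff' measurableSet_Ioi).2 (ae_of_all _ fun t (ht : 0 < t) => ?_)
      have h1 := hWC t ht.le
      rw [Real.norm_eq_abs, abs_mul, abs_of_pos (by positivity), ← hexp]
      calc t ^ k * Real.exp (-l * t) * |W t| ≤ t ^ k * Real.exp (-l * t) * (C * Real.exp (c * t)) :=
            mul_le_mul_of_nonneg_left h1 (by positivity)
        _ = _ := by ring
  have j1 : IntegrableOn (fun t : ℝ => t ^ (k + 2) * Real.exp (-s * t) -
      2 * x * (t ^ (k + 1) * Real.exp (-s * t))) (Ioi 0) :=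
    Integrable.sub i3 (Integrable.const_mul i2 (2 * x))
  have j2 : IntegrableOn (fun t : ℝ => t ^ (k + 2) * Real.exp (-s * t) -
      2 * x * (t ^ (k + 1) * Real.exp (-s * t)) + x ^ 2 * (t ^ k * Real.exp (-s * t))) (Ioi 0) :=
    Integrable.add j1 (Integrable.const_mul i1 (x ^ 2))
  have j3 : IntegrableOn (fun t : ℝ => K * (t ^ (k + 2) * Real.exp (-s * t) -
      2 * x * (t ^ (k + 1) * Real.exp (-s * t)) + x ^ 2 * (t ^ k * Real.exp (-s * t)))) (Ioi 0) :=
    Integrable.const_mul j2 K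
  have hbound : IntegrableOn (fun t : ℝ => ε * (t ^ k * Real.exp (-l * t)) +
      K * (t ^ (k + 2) * Real.exp (-s * t) - 2 * x * (t ^ (k + 1) * Real.exp (-s * t)) +
        x ^ 2 * (t ^ k * Real.exp (-s * t)))) (Ioi 0) :=
    Integrable.add (Integrable.const_mul i0 ε) j3
  have hval : A * ∫ t in Ioi (0 : ℝ), (ε * (t ^ k * Real.exp (-l * t)) +
      K * (t ^ (k + 2) * Real.exp (-s * t) - 2 * x * (t ^ (k + 1) * Real.exp (-s * t)) +
        x ^ 2 * (t ^ k * Real.exp (-s * t)))) =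
      ε + K * ((l / s) ^ (k + 1) * (((k + 1) / s - x) ^ 2 + (k + 1) / s / s)) := by
    rw [integral_add (Integrable.const_mul i0 ε) j3, integral_const_mul, integral_const_mul,
      integral_add j1 (Integrable.const_mul i1 (x ^ 2)),
      integral_sub i3 (Integrable.const_mul i2 (2 * x)),
      integral_const_mul, integral_const_mul, e0, e1, e2, e3, hA, Nat.factorial_succ (k + 1),
      Nat.factorial_succ k, div_pow, pow_succ s (k + 1 + 1), pow_succ s (k + 1)]
    have hP : s ^ (k + 1) ≠ 0 := by positivity
    have hL : l ^ (k + 1) ≠ 0 := by positivity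
    generalize s ^ (k + 1) = P at hP ⊢
    generalize l ^ (k + 1) = L at hL ⊢
    push_cast
    field_simp
    ring
  have hdiff : A * (∫ t in Ioi (0 : ℝ), t ^ k * Real.exp (-l * t) * W t) - W x =
      A * ∫ t in Ioi (0 : ℝ), (t ^ k * Real.exp (-l * t) * W t -
        W x * (t ^ k * Real.exp (-l * t))) := by
    rw [integral_sub iW (Integrable.const_mul i0 _), integral_const_mul, e0, hA]
    field_simp
  have hpow : (l / s) ^ (k + 1) ≤ Real.exp (c * ((k + 1) / s)) := by
    have h1 : l / s ≤ Real.exp (c / s) := by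
      have := Real.add_one_le_exp (c / s)
      have e : l / s = c / s + 1 := by field_simp; simp [s]
      rwa [e]
    calc (l / s) ^ (k + 1) ≤ Real.exp (c / s) ^ (k + 1) := pow_le_pow_left₀ (by positivity) h1 _
      _ = _ := by rw [← Real.exp_nat_mul]; push_cast; congr 1; ring
  rw [hdiff, abs_mul, abs_of_pos hA0]
  calc A * |∫ t in Ioi (0 : ℝ), (t ^ k * Real.exp (-l * t) * W t -
        W x * (t ^ k * Real.exp (-l * t)))|
      ≤ A * ∫ t in Ioi (0 : ℝ), (ε * (t ^ k * Real.exp (-l * t)) +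
      K * (t ^ (k + 2) * Real.exp (-s * t) - 2 * x * (t ^ (k + 1) * Real.exp (-s * t)) +
        x ^ 2 * (t ^ k * Real.exp (-s * t)))) := by
        refine mul_le_mul_of_nonneg_left ?_ hA0.le
        rw [← Real.norm_eq_abs]
        refine norm_integral_le_of_norm_le hbound ?_
        refine (ae_restrict_iff' measurableSet_Ioi).2 (ae_of_all _ fun t (ht : 0 < t) => ?_)
        have h1 := hWK t ht.le
        have e : t ^ k * Real.exp (-l * t) * W t - W x * (t ^ k * Real.exp (-l * t)) =
          t ^ k * Real.exp (-l * t) * (W t - W x) := by ring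
        rw [Real.norm_eq_abs, e, abs_mul, abs_of_pos (by positivity), ← hexp]
        calc t ^ k * Real.exp (-l * t) * |W t - W x|
            ≤ t ^ k * Real.exp (-l * t) * (ε + K * ((t - x) ^ 2 * Real.exp (c * t))) :=
              mul_le_mul_of_nonneg_left h1 (by positivity)
          _ = _ := by ring
    _ = _ := hval
    _ ≤ _ := by gcongr

theorem tendsto_gamma_average {W : ℝ → ℝ} (hW : ContinuousOn W (Ici 0)) {C c x : ℝ}
    (hc : 0 ≤ c) (hWC : ∀ t, 0 ≤ t → |W t| ≤ C * Real.exp (c * t)) (hx : 0 ≤ x)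
    {l : ℕ → ℝ} {k : ℕ → ℕ} (hl : Tendsto l atTop atTop)
    (hk : Tendsto (fun n => (k n : ℝ) / l n) atTop (𝓝 x)) :
    Tendsto (fun n => l n ^ (k n + 1) / (k n).factorial *
      ∫ t in Ioi (0 : ℝ), t ^ k n * Real.exp (-l n * t) * W t) atTop (𝓝 (W x)) := by
  have hls : Tendsto (fun n => l n - c) atTop atTop := by
    simpa only [sub_eq_add_neg] using tendsto_atTop_add_const_right _ (-c) hl
  have hr : Tendsto (fun n => ((k n : ℝ) + 1) / (l n - c)) atTop (𝓝 x) := by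
    have h1 : Tendsto (fun n => 1 / (1 - c * (l n)⁻¹)) atTop (𝓝 1) := by
      have := ((hl.inv_tendsto_atTop.const_mul c).const_sub 1).inv₀ (by simp)
      simpa using this
    have h2 := (hk.add hl.inv_tendsto_atTop).mul h1
    simp only [add_zero, mul_one] at h2
    refine h2.congr' ?_
    filter_upwards [hl.eventually_gt_atTop 0, hls.eventually_gt_atTop 0] with n h0 hs
    have : 1 - c * (l n)⁻¹ ≠ 0 := by
      have : 1 - c * (l n)⁻¹ = (l n - c) / l n := by field_simp
      rw [this]; positivity
    simp only [Pi.inv_apply]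
    have hs' := hs.ne'
    field_simp
  have hlim : Tendsto (fun n => Real.exp (c * (((k n : ℝ) + 1) / (l n - c))) *
        ((((k n : ℝ) + 1) / (l n - c) - x) ^ 2 + ((k n : ℝ) + 1) / (l n - c) / (l n - c)))
      atTop (𝓝 0) := by
    have h1 := (Real.continuous_exp.tendsto _).comp (hr.const_mul c)
    have h2 := ((hr.sub_const x).pow 2).add (hr.div_atTop hls)
    simpa using h1.mul h2
  rw [Metric.tendsto_atTop']
  intro ε hε
  obtain ⟨δ, hδ, hball⟩ := Metric.continuousWithinAt_iff.1 (hW x hx) (ε / 2) (half_pos hε)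
  have hC : 0 ≤ C := by
    have := (abs_nonneg _).trans (hWC 0 le_rfl)
    simpa using this
  set K := (C + |W x|) / δ ^ 2
  have hK : 0 ≤ K := by positivity
  have hWK : ∀ t, 0 ≤ t → |W t - W x| ≤ ε / 2 + K * ((t - x) ^ 2 * Real.exp (c * t)) := by
    intro t ht
    rcases lt_or_ge (dist t x) δ with h | h
    · have := (hball ht h).le
      rw [Real.dist_eq] at this
      have : 0 ≤ K * ((t - x) ^ 2 * Real.exp (c * t)) := by positivity
      linarith
    · rw [Real.dist_eq] at h
      have h1 : δ ^ 2 ≤ (t - x) ^ 2 := by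
        rw [← sq_abs (t - x)]; exact pow_le_pow_left₀ hδ.le h 2
      have h2 : 1 ≤ Real.exp (c * t) := Real.one_le_exp (by positivity)
      have h3 : (C + |W x|) * Real.exp (c * t) ≤ K * ((t - x) ^ 2 * Real.exp (c * t)) := by
        rw [← mul_assoc]
        refine mul_le_mul_of_nonneg_right ?_ (by positivity)
        calc C + |W x| = K * δ ^ 2 := by simp only [K]; field_simp
          _ ≤ _ := mul_le_mul_of_nonneg_left h1 hK
      have h4 := abs_sub (W t) (W x)
      have h5 := hWC t ht
      nlinarith [abs_nonneg (W x)]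
  have hev : ∀ᶠ n in atTop, K * (Real.exp (c * (((k n : ℝ) + 1) / (l n - c))) *
        ((((k n : ℝ) + 1) / (l n - c) - x) ^ 2 + ((k n : ℝ) + 1) / (l n - c) / (l n - c))) <
          ε / 2 := by
    have := hlim.const_mul K
    rw [mul_zero] at this
    exact this.eventually_lt_const (half_pos hε)
  obtain ⟨N, hN⟩ := eventually_atTop.1 (hev.and (hl.eventually_gt_atTop c))
  refine ⟨N, fun n hn => ?_⟩
  obtain ⟨h1, h2⟩ := hN n hn.le
  have := abs_gamma_average_sub_le hW hc hWC hK hWK h2 (k n)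
  rw [Real.dist_eq]
  linarith

theorem exists_abs_le_mul_exp_of_integrableOn {W : ℝ → ℝ} (hW : MonotoneOn W (Ici 0)) {l : ℝ}
    (hl : 0 ≤ l) (hi : IntegrableOn (fun y => Real.exp (-l * y) * W y) (Ioi 0)) :
    ∃ C, ∀ t, 0 ≤ t → |W t| ≤ C * Real.exp (l * t) := by
  set I := ∫ y in Ioi (0 : ℝ), ‖Real.exp (-l * y) * W y‖
  have hI : 0 ≤ I := integral_nonneg fun _ => norm_nonneg _
  refine ⟨|W 0| + I * Real.exp l, fun t ht => ?_⟩
  have h0 : W 0 ≤ W t := hW self_mem_Ici ht ht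
  have hexp : 1 ≤ Real.exp (l * t) := Real.one_le_exp (by positivity)
  have hIexp : 0 ≤ I * Real.exp l := by positivity
  rcases le_or_gt (W t) 0 with hWt | hWt
  · rw [abs_of_nonpos hWt]
    nlinarith [neg_abs_le (W 0), abs_nonneg (W 0)]
  have hmono : Real.exp (-l * (t + 1)) * W t ≤ I := by
    have hsub : Ioc t (t + 1) ⊆ Ioi 0 := fun y hy => ht.trans_lt hy.1
    have h1 := setIntegral_ge_of_const_le_real (μ := volume) (c := Real.exp (-l * (t + 1)) * W t)
      (f := fun y => ‖Real.exp (-l * y) * W y‖) measurableSet_Ioc (by simp) (fun y hy => ?_)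
      (hi.mono_set hsub).norm
    · simp only [Real.volume_real_Ioc, add_sub_cancel_left, zero_le_one, sup_of_le_left,
        mul_one] at h1
      exact h1.trans (setIntegral_mono_set hi.norm (ae_of_all _ fun _ => norm_nonneg _)
        (LE.le.eventuallyLE hsub))
    · have hy1 : W t ≤ W y := hW ht (ht.trans hy.1.le) hy.1.le
      rw [Real.norm_eq_abs, abs_of_pos (mul_pos (Real.exp_pos _) (hWt.trans_le hy1))]
      refine mul_le_mul (Real.exp_le_exp.2 ?_) hy1 hWt.le (Real.exp_pos _).le
      nlinarith [hy.2]
  rw [abs_of_pos hWt]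
  have e : Real.exp (-l * (t + 1)) * Real.exp l * Real.exp (l * t) = 1 := by
    rw [← Real.exp_add, ← Real.exp_add, Real.exp_eq_one_iff]
    ring
  calc W t = Real.exp (-l * (t + 1)) * W t * Real.exp l * Real.exp (l * t) := by
        linear_combination -W t * e
    _ ≤ I * Real.exp l * Real.exp (l * t) := by gcongr
    _ ≤ _ := by gcongr; linarith [abs_nonneg (W 0)]

namespace IsScaleFunction

variable {f W : ℝ → ℝ} {Φ q l : ℝ}

theorem integrableOn (hW : IsScaleFunction f Φ q W) (hf : ∀ l, Φ < l → q < f l) (hl : Φ < l) :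
    IntegrableOn (fun y => Real.exp (-l * y) * W y) (Ioi 0) := by
  refine .of_integral_ne_zero ?_
  rw [hW.2.2.2 l hl]
  exact one_div_ne_zero (sub_pos.2 (hf l hl)).ne'

theorem integral_pos (hW : IsScaleFunction f Φ q W) (hf : ∀ l, Φ < l → q < f l) (hl : Φ < l) :
    0 < ∫ y in Ioi (0 : ℝ), Real.exp (-l * y) * W y := by
  rw [hW.2.2.2 l hl]
  exact one_div_pos.2 (sub_pos.2 (hf l hl))

theorem exists_abs_le_mul_exp (hW : IsScaleFunction f Φ q W) (hf : ∀ l, Φ < l → q < f l)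
    (hΦ : 0 ≤ Φ) (hl : Φ < l) : ∃ C, ∀ t, 0 ≤ t → |W t| ≤ C * Real.exp (l * t) :=
  exists_abs_le_mul_exp_of_integrableOn hW.2.2.1 (hΦ.trans hl.le) (hW.integrableOn hf hl)

theorem nonneg (hW : IsScaleFunction f Φ q W) (hf : ∀ l, Φ < l → q < f l) (hΦ : 0 ≤ Φ) {t : ℝ}
    (ht : 0 ≤ t) : 0 ≤ W t := by
  refine le_trans ?_ (hW.2.2.1 self_mem_Ici ht ht)
  obtain ⟨C, hC⟩ := hW.exists_abs_le_mul_exp hf hΦ (lt_add_one Φ)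
  have := tendsto_gamma_average hW.2.1 (by linarith) hC le_rfl (l := fun n => (n : ℝ))
    (k := fun _ => 0) tendsto_natCast_atTop_atTop (by simp)
  refine ge_of_tendsto this ?_
  filter_upwards [tendsto_natCast_atTop_atTop.eventually_gt_atTop Φ] with n hn
  have h := (hW.integral_pos hf hn).le
  simpa using mul_nonneg n.cast_nonneg h

theorem exists_pos (hW : IsScaleFunction f Φ q W) (hf : ∀ l, Φ < l → q < f l) (hΦ : 0 ≤ Φ) :
    ∃ x, 0 < x ∧ 0 < W x := by
  by_contra! h
  refine (hW.integral_pos hf (lt_add_one Φ)).ne' ?_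
  rw [setIntegral_congr_fun (g := fun _ => (0 : ℝ)) measurableSet_Ioi fun t (ht : 0 < t) => ?_]
  · simp
  · simp [le_antisymm (h t ht) (hW.nonneg hf hΦ ht.le)]

theorem iteratedDeriv_laplace (hW : IsScaleFunction f Φ q W) (hf : ∀ l, Φ < l → q < f l)
    (hΦ : 0 ≤ Φ) (hl : Φ < l) (n : ℕ) :
    AnalyticAt ℝ (fun l => ∫ y in Ioi (0 : ℝ), Real.exp (-l * y) * W y) l ∧
    IntegrableOn (fun t => t ^ n * Real.exp (-l * t) * W t) (Ioi 0) ∧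
    iteratedDeriv n (fun l => ∫ y in Ioi (0 : ℝ), Real.exp (-l * y) * W y) l =
      (-1) ^ n * ∫ t in Ioi (0 : ℝ), t ^ n * Real.exp (-l * t) * W t := by
  have hWm : AEMeasurable W (volume.restrict (Ioi 0)) :=
    (hW.2.1.mono Ioi_subset_Ici_self).aemeasurable measurableSet_Ioi
  have hW0 : ∀ᵐ z ∂volume.restrict (Ioi (0 : ℝ)), 0 ≤ W z :=
    (ae_restrict_iff' measurableSet_Ioi).2
      (ae_of_all _ fun t (ht : 0 < t) => hW.nonneg hf hΦ ht.le)
  obtain ⟨h1, h2, h3⟩ := iteratedDeriv_integral_exp_neg_mul_mul hWm hW0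
    (fun _ h => hW.integrableOn hf h) hl n
  have e : ∀ t : ℝ, (-t) ^ n * Real.exp (-l * t) * W t =
      (-1) ^ n * (t ^ n * Real.exp (-l * t) * W t) := fun t => by
    rw [neg_pow]; ring
  simp only [e] at h2 h3
  refine ⟨h1, ?_, by rw [h3, integral_const_mul]⟩
  have := h2.const_mul ((-1) ^ n)
  refine this.congr (ae_of_all _ fun t => ?_)
  simp only [← mul_assoc, ← mul_pow]
  simp

theorem moment_pos (hW : IsScaleFunction f Φ q W) (hf : ∀ l, Φ < l → q < f l)
    (hΦ : 0 ≤ Φ) (hl : Φ < l) (n : ℕ) :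
    0 < ∫ t in Ioi (0 : ℝ), t ^ n * Real.exp (-l * t) * W t := by
  obtain ⟨-, hi, -⟩ := hW.iteratedDeriv_laplace hf hΦ hl n
  have h0 : ∀ᵐ t ∂volume.restrict (Ioi (0 : ℝ)), 0 ≤ t ^ n * Real.exp (-l * t) * W t :=
    (ae_restrict_iff' measurableSet_Ioi).2 (ae_of_all _ fun t (ht : 0 < t) =>
      mul_nonneg (by positivity) (hW.nonneg hf hΦ ht.le))
  refine lt_of_le_of_ne (integral_nonneg_of_ae h0) fun h => (hW.integral_pos hf hl).ne' ?_
  have h1 := (integral_eq_zero_iff_of_nonneg_ae h0 hi).1 h.symm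
  refine integral_eq_zero_of_ae ?_
  filter_upwards [h1, ae_restrict_mem measurableSet_Ioi] with t ht (ht0 : 0 < t)
  have hWt : W t = 0 := by
    simpa [ht0.ne'] using ht
  simp [hWt]

theorem moment_log_concave (hW : IsScaleFunction f Φ q W) (hf : ∀ l, Φ < l → q < f l)
    (hΦ : 0 ≤ Φ) (hfd : ∀ l, Φ < l → ∀ k, 0 ≤ (-1) ^ k * iteratedDeriv (k + 2) f l)
    (hl : Φ < l) {j k : ℕ} (hjk : j ≤ k) (N : ℕ) :
    (1 / j.factorial * ∫ t in Ioi (0 : ℝ), t ^ j * Real.exp (-l * t) * W t) *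
        (1 / (k + N).factorial * ∫ t in Ioi (0 : ℝ), t ^ (k + N) * Real.exp (-l * t) * W t) ≤
      (1 / (j + N).factorial * ∫ t in Ioi (0 : ℝ), t ^ (j + N) * Real.exp (-l * t) * W t) *
        (1 / k.factorial * ∫ t in Ioi (0 : ℝ), t ^ k * Real.exp (-l * t) * W t) := by
  set F : ℝ → ℝ := fun l => ∫ y in Ioi (0 : ℝ), Real.exp (-l * y) * W y with hF
  set a : ℕ → ℝ := fun n =>
    1 / n.factorial * ∫ t in Ioi (0 : ℝ), t ^ n * Real.exp (-l * t) * W t with ha_def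
  have ha : ∀ n, 0 < a n := fun n => mul_pos (by positivity) (hW.moment_pos hf hΦ hl n)
  have haF : ∀ n, iteratedDeriv n F l = (-1) ^ n * n.factorial * a n := fun n => by
    rw [(hW.iteratedDeriv_laplace hf hΦ hl n).2.2]
    have : (n.factorial : ℝ) ≠ 0 := by positivity
    simp only [ha_def]
    field_simp
  set G : ℝ → ℝ := fun l => f l - q with hG
  have hGF : ∀ᶠ y in 𝓝 l, G y = (F y)⁻¹ := by
    filter_upwards [lt_mem_nhds hl] with y hy
    simp only [F, G, hW.2.2.2 y hy, one_div, inv_inv]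
  have hFa : AnalyticAt ℝ F l := (hW.iteratedDeriv_laplace hf hΦ hl 0).1
  have hGa : AnalyticAt ℝ G l :=
    (hFa.inv (hW.integral_pos hf hl).ne').congr (hGF.mono fun _ h => h.symm)
  have hone : G * F =ᶠ[𝓝 l] fun _ => 1 := by
    filter_upwards [hGF, lt_mem_nhds hl] with y hy hy'
    rw [Pi.mul_apply, hy, inv_mul_cancel₀ (hW.integral_pos hf hy').ne']
  refine log_concave_shift ha (log_concave_of_convolution_eq_zero
    (b := fun j => (-1) ^ j / j.factorial * iteratedDeriv j G l) ha ?_ ?_ ?_) hjk N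
  · simpa [G] using hf l hl
  · intro j
    have e : iteratedDeriv (j + 2) G l = iteratedDeriv (j + 2) f l := by
      rw [iteratedDeriv_succ', iteratedDeriv_succ' (f := f)]
      congr 1
      ext y
      exact deriv_sub_const _
    simp only [e, pow_add]
    have := hfd l hl j
    rw [div_mul_eq_mul_div]
    have e2 : (-1 : ℝ) ^ 2 = 1 := by norm_num
    rw [e2, mul_one]
    positivity
  · intro n
    have h1 := hone.iteratedDeriv_eq (n + 1)
    rw [iteratedDeriv_const, if_neg n.succ_ne_zero,
      iteratedDeriv_mul hGa.contDiffAt hFa.contDiffAt] at h1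
    have h2 : (-1) ^ (n + 1) * ((n + 1).factorial : ℝ) *
        ∑ j ∈ Finset.range (n + 2), (-1) ^ j / j.factorial * iteratedDeriv j G l * a (n + 1 - j) =
        0 := by
      rw [← h1, Finset.mul_sum]
      refine Finset.sum_congr rfl fun j hj => ?_
      have hj' : j ≤ n + 1 := Nat.lt_succ_iff.1 (Finset.mem_range.1 hj)
      rw [haF, Nat.cast_choose ℝ hj']
      have e : (-1 : ℝ) ^ (n + 1) * (-1) ^ j = (-1) ^ (n + 1 - j) := by
        obtain ⟨d, hd⟩ := Nat.exists_eq_add_of_le hj'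
        rw [hd, Nat.add_sub_cancel_left, mul_comm, pow_add, ← mul_assoc, ← mul_pow]
        simp
      rw [← e]
      have : (j.factorial : ℝ) ≠ 0 := by positivity
      have : ((n + 1 - j).factorial : ℝ) ≠ 0 := by positivity
      field_simp
    exact (mul_eq_zero.1 h2).resolve_left (by positivity)

/-- A scale function is log-concave on `[0, ∞)`, by Post inversion of `moment_log_concave`. -/
theorem log_concave (hW : IsScaleFunction f Φ q W) (hf : ∀ l, Φ < l → q < f l)
    (hΦ : 0 ≤ Φ) (hfd : ∀ l, Φ < l → ∀ k, 0 ≤ (-1) ^ k * iteratedDeriv (k + 2) f l)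
    {x y h : ℝ} (hy : 0 ≤ y) (hyx : y ≤ x) (hh : 0 < h) :
    W y * W (x + h) ≤ W (y + h) * W x := by
  obtain ⟨C, hC⟩ := hW.exists_abs_le_mul_exp hf hΦ (lt_add_one Φ)
  have hx := hy.trans hyx
  set l : ℕ → ℝ := fun n => n / h with hl_def
  have hl : Tendsto l atTop atTop := tendsto_natCast_atTop_atTop.atTop_div_const hh
  have hfloor : ∀ {z : ℝ}, 0 ≤ z → Tendsto (fun n => (⌊z * l n⌋₊ : ℝ) / l n) atTop (𝓝 z) :=
    fun hz => (tendsto_nat_floor_mul_div_atTop hz).comp hl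
  have hshift : ∀ {z : ℝ}, 0 ≤ z →
      Tendsto (fun n => ((⌊z * l n⌋₊ + n : ℕ) : ℝ) / l n) atTop (𝓝 (z + h)) := fun hz => by
    refine ((hfloor hz).add_const h).congr' ?_
    filter_upwards [eventually_gt_atTop 0] with n hn
    have : (n : ℝ) ≠ 0 := by positivity
    push_cast
    rw [add_div]
    congr 1
    simp only [l]
    field_simp
  have hav : ∀ {z : ℝ} {k : ℕ → ℕ}, 0 ≤ z → Tendsto (fun n => (k n : ℝ) / l n) atTop (𝓝 z) → _ :=
    fun hz hk => tendsto_gamma_average hW.2.1 (by linarith) hC hz hl hk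
  refine le_of_tendsto_of_tendsto ((hav hy (hfloor hy)).mul (hav (by linarith) (hshift hx)))
    ((hav (by linarith) (hshift hy)).mul (hav hx (hfloor hx))) ?_
  filter_upwards [hl.eventually_gt_atTop Φ] with n hn
  have hln : 0 < l n := hΦ.trans_lt hn
  have hjk : ⌊y * l n⌋₊ ≤ ⌊x * l n⌋₊ := Nat.floor_mono (by gcongr)
  have := mul_le_mul_of_nonneg_left (hW.moment_log_concave hf hΦ hfd hn hjk n)
    (pow_nonneg hln.le (⌊y * l n⌋₊ + 1 + (⌊x * l n⌋₊ + n + 1)))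
  convert this using 1 <;> ring

theorem not_le_mul_exp (hW : IsScaleFunction f Φ q W) (hf : ∀ l, Φ < l → q < f l)
    (hΦ : f Φ = q) (hc : ContinuousAt f Φ) {μ C : ℝ} (hμ0 : 0 ≤ μ) (hμ : μ < Φ)
    (h : ∀ t, 0 ≤ t → W t ≤ C * Real.exp (μ * t)) : False := by
  have hΦ0 : 0 ≤ Φ := hμ0.trans hμ.le
  have hC : 0 ≤ C := by
    simpa using (hW.nonneg hf hΦ0 le_rfl).trans (h 0 le_rfl)
  have hb : ∀ l, Φ < l → Φ - μ ≤ C * (f l - q) := by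
    intro l hl
    have hs : 0 < l - μ := by linarith
    have hfl : 0 < f l - q := sub_pos.2 (hf l hl)
    obtain ⟨i0, e0⟩ := integral_pow_mul_exp_neg_mul_Ioi 0 hs
    simp only [pow_zero, one_mul, Nat.factorial_zero, Nat.cast_one, zero_add, pow_one] at i0 e0
    have h1 : 1 / (f l - q) ≤ C * (1 / (l - μ)) := by
      rw [← hW.2.2.2 l hl, ← e0, ← integral_const_mul]
      refine setIntegral_mono_on (hW.integrableOn hf hl) (i0.const_mul C) measurableSet_Ioi
        fun t (ht : 0 < t) => ?_
      calc Real.exp (-l * t) * W t ≤ Real.exp (-l * t) * (C * Real.exp (μ * t)) :=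
            mul_le_mul_of_nonneg_left (h t ht.le) (Real.exp_pos _).le
        _ = C * Real.exp (-(l - μ) * t) := by
            rw [mul_left_comm, ← Real.exp_add]; ring_nf
    rw [mul_one_div, div_le_div_iff₀ hfl hs] at h1
    linarith
  have ht : Tendsto (fun l => C * (f l - q)) (𝓝[>] Φ) (𝓝 0) := by
    have := ((hc.tendsto.mono_left (nhdsWithin_le_nhds (s := Ioi Φ))).sub_const q).const_mul C
    simpa [hΦ] using this
  have := ge_of_tendsto ht (eventually_nhdsWithin_of_forall hb)
  linarith

end IsScaleFunction

theorem tendsto_add_div_of_log_concave {W : ℝ → ℝ} {Φ x₀ : ℝ} (hmono : MonotoneOn W (Ici 0))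
    (hx₀ : 0 < x₀) (hWx₀ : 0 < W x₀)
    (hlc : ∀ {x y h : ℝ}, 0 ≤ y → y ≤ x → 0 < h → W y * W (x + h) ≤ W (y + h) * W x)
    (hup : ∀ {l}, Φ < l → ∃ C, ∀ t, 0 ≤ t → |W t| ≤ C * Real.exp (l * t))
    (hlow : ∀ {μ C}, 0 ≤ μ → μ < Φ → ¬ ∀ t, 0 ≤ t → W t ≤ C * Real.exp (μ * t))
    {h : ℝ} (hh : 0 < h) :
    Tendsto (fun m => W (m + h) / W m) atTop (𝓝 (Real.exp (Φ * h))) := by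
  have hpos : ∀ t, x₀ ≤ t → 0 < W t := fun t ht =>
    hWx₀.trans_le (hmono hx₀.le (hx₀.le.trans ht) ht)
  have hanti : ∀ {y x}, x₀ ≤ y → y ≤ x → W (x + h) / W x ≤ W (y + h) / W y := fun hy hyx => by
    rw [div_le_div_iff₀ (hpos _ (hy.trans hyx)) (hpos _ hy), mul_comm]
    exact hlc (hx₀.le.trans hy) hyx hh
  have hlower : ∀ m, x₀ ≤ m → Real.exp (Φ * h) ≤ W (m + h) / W m := by
    intro m hm
    by_contra! hr
    have hm0 : 0 < m := hx₀.trans_le hm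
    set r := W (m + h) / W m with hr_def
    have hr1 : 1 ≤ r := (one_le_div (hpos m hm)).2
      (hmono hm0.le (hm0.le.trans (by linarith)) (by linarith))
    have hr0 : 0 < r := by linarith
    have hiter : ∀ n : ℕ, W (m + n * h) ≤ r ^ n * W m := by
      intro n
      induction n with
      | zero => simp
      | succ n ih =>
        have hmn : m ≤ m + n * h := by nlinarith [n.cast_nonneg (α := ℝ)]
        have h1 := hanti hm hmn
        rw [← hr_def, div_le_iff₀ (hpos _ (hm.trans hmn))] at h1
        calc W (m + (n + 1 : ℕ) * h) = W (m + n * h + h) := by push_cast; ring_nf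
          _ ≤ r * W (m + n * h) := h1
          _ ≤ r * (r ^ n * W m) := by gcongr
          _ = _ := by ring
    have hμr : r = Real.exp (Real.log r / h * h) := by
      rw [div_mul_cancel₀ _ hh.ne', Real.exp_log hr0]
    have hμ0 : 0 ≤ Real.log r / h := div_nonneg (Real.log_nonneg hr1) hh.le
    have hμ : Real.log r / h < Φ := by
      rw [hμr, Real.exp_lt_exp] at hr
      exact lt_of_mul_lt_mul_right hr hh.le
    set μ := Real.log r / h
    refine hlow (C := Real.exp (μ * h) * W m) hμ0 hμ fun t ht => ?_
    have hn1 : t ≤ ⌈t / h⌉₊ * h := (div_le_iff₀ hh).1 (Nat.le_ceil _)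
    have hn2 : ⌈t / h⌉₊ * h ≤ t + h := by
      have := mul_le_mul_of_nonneg_right (Nat.ceil_lt_add_one (div_nonneg ht hh.le)).le hh.le
      rwa [add_mul, div_mul_cancel₀ _ hh.ne', one_mul] at this
    calc W t ≤ W (m + ⌈t / h⌉₊ * h) := hmono ht (ht.trans (by linarith)) (by linarith)
      _ ≤ r ^ ⌈t / h⌉₊ * W m := hiter _
      _ = Real.exp (μ * (⌈t / h⌉₊ * h)) * W m := by
        rw [hμr, ← Real.exp_nat_mul]; ring_nf
      _ ≤ Real.exp (μ * (t + h)) * W m := by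
        have := hpos m hm
        gcongr
      _ = _ := by rw [mul_add, Real.exp_add]; ring
  have hupper : ∀ l, Φ < l → ∃ m, x₀ ≤ m ∧ W (m + h) / W m < Real.exp (l * h) := by
    intro l hl
    by_contra! hge
    have hiter : ∀ n : ℕ, Real.exp (l * h) ^ n * W x₀ ≤ W (x₀ + n * h) := by
      intro n
      induction n with
      | zero => simp
      | succ n ih =>
        have hmn : x₀ ≤ x₀ + n * h := by nlinarith [n.cast_nonneg (α := ℝ)]
        have h1 := hge _ hmn
        rw [le_div_iff₀ (hpos _ hmn)] at h1
        calc Real.exp (l * h) ^ (n + 1) * W x₀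
            = Real.exp (l * h) * (Real.exp (l * h) ^ n * W x₀) := by ring
          _ ≤ Real.exp (l * h) * W (x₀ + n * h) := by gcongr
          _ ≤ W (x₀ + n * h + h) := h1
          _ = _ := by push_cast; ring_nf
    obtain ⟨l', hΦl', hl'⟩ := exists_between hl
    obtain ⟨C, hC⟩ := hup hΦl'
    have hone : 1 < Real.exp ((l - l') * h) :=
      Real.one_lt_exp_iff.2 (mul_pos (sub_pos.2 hl') hh)
    obtain ⟨n, hn⟩ := pow_unbounded_of_one_lt (C * Real.exp (l' * x₀) / W x₀) hone
    rw [div_lt_iff₀ hWx₀] at hn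
    have h1 := (hiter n).trans ((le_abs_self _).trans (hC (x₀ + n * h) (by positivity)))
    have h2 := mul_lt_mul_of_pos_left hn (Real.exp_pos (l' * (n * h)))
    have e1 : Real.exp (l' * (n * h)) * (Real.exp ((l - l') * h) ^ n * W x₀) =
        Real.exp (l * h) ^ n * W x₀ := by
      rw [← mul_assoc, ← Real.exp_nat_mul, ← Real.exp_nat_mul, ← Real.exp_add]
      ring_nf
    have e2 : Real.exp (l' * (n * h)) * (C * Real.exp (l' * x₀)) =
        C * Real.exp (l' * (x₀ + n * h)) := by
      rw [mul_left_comm, ← Real.exp_add]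
      ring_nf
    linarith
  refine tendsto_order.2 ⟨fun a ha => ?_, fun b hb => ?_⟩
  · filter_upwards [eventually_ge_atTop x₀] with m hm using ha.trans_le (hlower m hm)
  · have hb0 : 0 < b := (Real.exp_pos _).trans hb
    have hl : Φ < Real.log b / h := by
      rwa [lt_div_iff₀ hh, Real.lt_log_iff_exp_lt hb0]
    obtain ⟨m, hm, hmb⟩ := hupper _ hl
    rw [div_mul_cancel₀ _ hh.ne', Real.exp_log hb0] at hmb
    filter_upwards [eventually_ge_atTop m] with x hx using (hanti hm hx).trans_lt hmb

theorem tendsto_add_div_of_pos {W : ℝ → ℝ} {Φ : ℝ}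
    (h : ∀ h, 0 < h → Tendsto (fun m => W (m + h) / W m) atTop (𝓝 (Real.exp (Φ * h)))) (x : ℝ) :
    Tendsto (fun m => W (x + m) / W m) atTop (𝓝 (Real.exp (Φ * x))) := by
  rcases lt_trichotomy x 0 with hx | rfl | hx
  · have h1 := ((h (-x) (neg_pos.2 hx)).comp (tendsto_atTop_add_const_left _ x tendsto_id)).inv₀
      (Real.exp_ne_zero _)
    rw [← Real.exp_neg, mul_neg, neg_neg] at h1
    refine h1.congr fun m => ?_
    simp
  · have h1 := h 1 one_pos
    have h2 : ∀ᶠ m in atTop, W m ≠ 0 := by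
      filter_upwards [h1.eventually_ne (Real.exp_ne_zero _)] with m hm h0
      simp [h0] at hm
    simp only [zero_add, mul_zero, Real.exp_zero]
    refine tendsto_const_nhds.congr' ?_
    filter_upwards [h2] with m hm using (div_self hm).symm
  · simpa only [add_comm x] using h x hx

theorem tendsto_deriv_div_of_log_concave {W W' : ℝ → ℝ} {Φ x₀ : ℝ} (hx₀ : 0 < x₀)
    (hpos : ∀ t, x₀ ≤ t → 0 < W t)
    (hlc : ∀ {x y h : ℝ}, 0 ≤ y → y ≤ x → 0 < h → W y * W (x + h) ≤ W (y + h) * W x)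
    (hd : ∀ y, 0 < y → HasDerivAt W (W' y) y)
    (hratio : Tendsto (fun m => W (1 + m) / W m) atTop (𝓝 (Real.exp Φ))) :
    Tendsto (fun m => W' m / W m) atTop (𝓝 Φ) := by
  have hanti : ∀ {y x}, x₀ ≤ y → y ≤ x → W' x / W x ≤ W' y / W y := by
    intro y x hy hyx
    have hy0 : 0 < y := hx₀.trans_le hy
    rw [div_le_div_iff₀ (hpos _ (hy.trans hyx)) (hpos _ hy), mul_comm]
    have hx := (hd x (hy0.trans_le hyx)).tendsto_slope_zero_right
    have hy' := (hd y hy0).tendsto_slope_zero_right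
    refine le_of_tendsto_of_tendsto (hx.const_mul (W y)) (hy'.mul_const (W x)) ?_
    filter_upwards [self_mem_nhdsWithin] with h (hh : 0 < h)
    have := mul_le_mul_of_nonneg_left (hlc hy0.le hyx hh) (inv_nonneg.2 hh.le)
    simp only [smul_eq_mul]
    linarith
  have hlog : Tendsto (fun m => Real.log (W (1 + m)) - Real.log (W m)) atTop (𝓝 Φ) := by
    have h1 := hratio.log (Real.exp_ne_zero _)
    rw [Real.log_exp] at h1
    refine h1.congr' ?_
    filter_upwards [eventually_ge_atTop x₀] with m hm
    rw [Real.log_div (hpos _ (by linarith)).ne' (hpos _ hm).ne']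
  have hmvt : ∀ m, x₀ ≤ m → ∃ ξ ∈ Ioo m (1 + m),
      W' ξ / W ξ = Real.log (W (1 + m)) - Real.log (W m) := by
    intro m hm
    have hd' : ∀ ξ, m ≤ ξ → HasDerivAt (fun t => Real.log (W t)) (W' ξ / W ξ) ξ := fun ξ hξ =>
      (hd ξ (by linarith)).log (hpos ξ (hm.trans hξ)).ne'
    obtain ⟨ξ, hξ, e⟩ := exists_hasDerivAt_eq_slope (fun t => Real.log (W t))
      (fun ξ => W' ξ / W ξ) (by linarith : m < 1 + m)
      (fun ξ hξ => (hd' ξ hξ.1).continuousAt.continuousWithinAt) (fun ξ hξ => hd' ξ hξ.1.le)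
    exact ⟨ξ, hξ, by simpa using e⟩
  refine tendsto_of_tendsto_of_tendsto_of_le_of_le' hlog
    (hlog.comp (tendsto_atTop_add_const_right _ (-1) tendsto_id)) ?_ ?_
  · filter_upwards [eventually_ge_atTop x₀] with m hm
    obtain ⟨ξ, hξ, e⟩ := hmvt m hm
    exact e ▸ hanti hm hξ.1.le
  · filter_upwards [eventually_ge_atTop (x₀ + 1)] with m hm
    obtain ⟨ξ, hξ, e⟩ := hmvt (m + -1) (by linarith)
    simp only [Function.comp_apply, id_eq]
    rw [← e]
    exact hanti (by linarith [hξ.1]) (by linarith [hξ.2])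

/-- For `q > 0` and every `x ∈ ℝ`, `lim_{m→∞} W^{(q)}(x+m)/W^{(q)}(m) = e^{Φ(q)x}`;
moreover, if `W^{(q)}` is continuously differentiable on `(0,∞)` with derivative
`W^{(q)′}`, then `lim_{m→∞} W^{(q)′}(x+m)/W^{(q)}(m) = Φ(q) e^{Φ(q)x}`. -/
theorem scale_function_ratio_limit
    (γ σ : ℝ) (hσ : 0 ≤ σ) (ν : Measure ℝ) (hν : IsLevyMeasure ν)
    (hnd : NonDegenerate γ σ ν)
    (q : ℝ) (hq : 0 < q) (W W' : ℝ → ℝ)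
    (hW : IsScaleFunction (levyPsi γ σ ν) (levyPhi (levyPsi γ σ ν) q) q W) :
    (∀ x : ℝ, Tendsto (fun m : ℝ => W (x + m) / W m) atTop
      (nhds (Real.exp (levyPhi (levyPsi γ σ ν) q * x)))) ∧
    (((∀ y : ℝ, 0 < y → HasDerivAt W (W' y) y) ∧ ContinuousOn W' (Set.Ioi 0)) →
      ∀ x : ℝ, Tendsto (fun m : ℝ => W' (x + m) / W m) atTop
        (nhds (levyPhi (levyPsi γ σ ν) q * Real.exp (levyPhi (levyPsi γ σ ν) q * x)))) := by
  obtain ⟨hΦ0, hΦ, hf⟩ := levyPhi_spec hσ hν hnd hq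
  set f := levyPsi γ σ ν
  set Φ := levyPhi f q
  have hlc : ∀ {x y h : ℝ}, 0 ≤ y → y ≤ x → 0 < h → W y * W (x + h) ≤ W (y + h) * W x :=
    fun hy hyx hh => hW.log_concave hf hΦ0.le (fun l hl k =>
      hν.neg_one_pow_mul_iteratedDeriv_levyPsi_nonneg (hΦ0.trans hl) k) hy hyx hh
  obtain ⟨x₀, hx₀, hWx₀⟩ := hW.exists_pos hf hΦ0.le
  have hratio : ∀ x : ℝ, Tendsto (fun m => W (x + m) / W m) atTop (𝓝 (Real.exp (Φ * x))) :=
    tendsto_add_div_of_pos fun h hh => tendsto_add_div_of_log_concave hW.2.2.1 hx₀ hWx₀ hlc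
      (fun hl => hW.exists_abs_le_mul_exp hf hΦ0.le hl)
      (fun hμ0 hμ => hW.not_le_mul_exp hf hΦ (hν.hasDerivAt_levyPsi hΦ0).continuousAt hμ0 hμ) hh
  refine ⟨hratio, fun ⟨hd, _⟩ x => ?_⟩
  have hpos : ∀ t, x₀ ≤ t → 0 < W t := fun t ht =>
    hWx₀.trans_le (hW.2.2.1 hx₀.le (hx₀.le.trans ht) ht)
  have hderiv := tendsto_deriv_div_of_log_concave hx₀ hpos hlc hd (by simpa using hratio 1)
  refine ((hderiv.comp (tendsto_atTop_add_const_left _ x tendsto_id)).mul (hratio x)).congr' ?_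
  filter_upwards [eventually_ge_atTop (x₀ - x)] with m hm
  exact div_mul_div_cancel₀ (hpos (x + m) (by linarith)).ne'
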